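/- Let K = u/v be shift-reduced with K ≠ 1, and let S ∈ F(y). Then there exist S₁ ∈ F(y) and polynomials a, b, p ∈ F[y] with b nonzero, shift-free, and strongly prime with K, such that S = K·σ(S₁) − S₁ + a/b + p/v. -/

import Mathlib

open Polynomial

noncomputable def pshift (F : Type*) [Field F] (i : ℤ) :
    Polynomial F →ₐ[F] Polynomial F :=
  aeval (X + C (i : F))

noncomputable def rshift (F : Type*) [Field F] (i : ℤ) : RatFunc F → RatFunc F :=
  fun f => RatFunc.mk (pshift F i f.num) (pshift F i f.denom)

def shiftFree {F : Type*} [Field F] (p : Polynomial F) : Prop :=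
  p ≠ 0 ∧ ∀ i : ℤ, i ≠ 0 → IsCoprime p (pshift F i p)

def shiftReducedPair {F : Type*} [Field F] (u v : Polynomial F) : Prop :=
  u ≠ 0 ∧ v ≠ 0 ∧ IsCoprime u v ∧ ∀ i : ℤ, IsCoprime u (pshift F i v)

def stronglyPrime {F : Type*} [Field F] (p u v : Polynomial F) : Prop :=
  p ≠ 0 ∧ ∀ i : ℕ, IsCoprime p (pshift F (-(i : ℤ)) u) ∧ IsCoprime p (pshift F (i : ℤ) v)

noncomputable def phiK {F : Type*} [Field F] (u v : Polynomial F) :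
    Polynomial F → Polynomial F :=
  fun p => u * pshift F 1 p - v * p

noncomputable def WK (F : Type*) [Field F] (u v : Polynomial F) :
    Submodule F (Polynomial F) :=
  Submodule.span F {q : Polynomial F | ∃ ℓ : ℕ, q = X ^ ℓ ∧
    ∀ w : Polynomial F, w ∈ Set.range (phiK u v) → w ≠ 0 → ℓ ≠ w.natDegree}

def VK {F : Type*} [Field F] (K : RatFunc F) : Set (RatFunc F) :=
  {g | ∃ r : RatFunc F, g = K * rshift F 1 r - r}

def residualForm {F : Type*} [Field F] (u v : Polynomial F) (r : RatFunc F) : Prop :=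
  ∃ a b q : Polynomial F, a.degree < b.degree ∧ shiftFree b ∧ stronglyPrime b u v ∧
    q ∈ WK F u v ∧ r = RatFunc.mk a b + RatFunc.mk q v

section Shift

variable {F : Type*} [Field F]

theorem pshift_eq_comp (i : ℤ) (p : F[X]) : pshift F i p = p.comp (X + C (i : F)) := by
  simp [pshift, Polynomial.comp, Polynomial.aeval_def]

theorem pshift_pshift (i j : ℤ) (p : F[X]) :
    pshift F i (pshift F j p) = pshift F (i + j) p := by
  simp only [pshift_eq_comp, comp_assoc]
  congr 1
  simp [add_assoc]

theorem pshift_zero_index (p : F[X]) : pshift F 0 p = p := by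
  simp [pshift_eq_comp]

theorem natDegree_pshift (i : ℤ) (p : F[X]) : (pshift F i p).natDegree = p.natDegree := by
  rw [pshift_eq_comp, natDegree_comp, natDegree_X_add_C, mul_one]

theorem leadingCoeff_pshift (i : ℤ) (p : F[X]) :
    (pshift F i p).leadingCoeff = p.leadingCoeff := by
  rw [pshift_eq_comp, leadingCoeff_comp (by rw [natDegree_X_add_C]; exact one_ne_zero),
    leadingCoeff_X_add_C, one_pow, mul_one]

theorem pshift_ne_zero {i : ℤ} {p : F[X]} (hp : p ≠ 0) : pshift F i p ≠ 0 := by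
  rwa [← leadingCoeff_ne_zero, leadingCoeff_pshift, leadingCoeff_ne_zero]

theorem isCoprime_pshift {p q : F[X]} (i : ℤ) (h : IsCoprime p q) :
    IsCoprime (pshift F i p) (pshift F i q) :=
  h.map (pshift F i).toRingHom

theorem isCoprime_pshift_pshift_iff {i j : ℤ} {p q : F[X]} :
    IsCoprime (pshift F i p) (pshift F j q) ↔ IsCoprime p (pshift F (j - i) q) := by
  constructor <;> intro h
  · have := isCoprime_pshift (-i) h
    rw [pshift_pshift, pshift_pshift] at this
    rwa [neg_add_cancel, pshift_zero_index, neg_add_eq_sub] at this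
  · have := isCoprime_pshift i h
    rwa [pshift_pshift, add_sub_cancel] at this

theorem isCoprime_pshift_left_iff {i : ℤ} {p q : F[X]} :
    IsCoprime (pshift F i p) q ↔ IsCoprime p (pshift F (-i) q) := by
  rw [← zero_sub, ← isCoprime_pshift_pshift_iff (i := i) (j := 0), pshift_zero_index]

theorem irreducible_pshift {i : ℤ} {q : F[X]} (hq : Irreducible q) :
    Irreducible (pshift F i q) := by
  let e : F[X] ≃ₐ[F] F[X] := AlgEquiv.ofAlgHom (pshift F i) (pshift F (-i))
    (AlgHom.ext fun p => by simp [pshift_pshift, pshift_zero_index])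
    (AlgHom.ext fun p => by simp [pshift_pshift, pshift_zero_index])
  exact (MulEquiv.irreducible_iff e.toMulEquiv).2 hq

theorem isCoprime_pshift_self [CharZero F] {q : F[X]} (hq : Irreducible q) {i : ℤ}
    (hi : i ≠ 0) : IsCoprime q (pshift F i q) := by
  rw [hq.coprime_iff_not_dvd]
  intro hdvd
  have heq : pshift F i q = q := by
    symm
    exact eq_of_dvd_of_natDegree_le_of_leadingCoeff hdvd (natDegree_pshift i q).le
      (leadingCoeff_pshift i q).symm
  have heval : ∀ n : ℕ, q.eval ((n : F) * i) = q.eval 0 := by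
    intro n
    induction n with
    | zero => simp
    | succ n ih =>
      rw [← ih]
      conv_rhs => rw [← heq, pshift_eq_comp, eval_comp]
      simp [add_mul]
  have hconst : q = C (q.eval 0) := by
    refine eq_of_infinite_eval_eq _ _ (Set.Infinite.mono ?_
      (Set.infinite_range_of_injective (f := fun n : ℕ => (n : F) * i) ?_))
    · rintro _ ⟨n, rfl⟩
      simp [heval n]
    · intro m n h
      have hi' : (i : F) ≠ 0 := Int.cast_ne_zero.2 hi
      exact_mod_cast mul_right_cancel₀ hi' h
  exact hq.natDegree_pos.ne' (by rw [hconst, natDegree_C])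

theorem finite_setOf_not_isCoprime_pshift [CharZero F] {q : F[X]} (hq : Irreducible q)
    {w : F[X]} (hw : w ≠ 0) : {j : ℤ | ¬ IsCoprime q (pshift F j w)}.Finite := by
  induction w using UniqueFactorizationMonoid.induction_on_prime with
  | h₁ => exact absurd rfl hw
  | h₂ w hu =>
    convert Set.finite_empty
    ext j
    have : IsUnit (pshift F j w) := hu.map (pshift F j)
    simpa using (isCoprime_one_right (x := q)).of_isCoprime_of_dvd_right this.dvd
  | h₃ w p hw0 hp ih =>
    refine Set.Finite.subset ((Set.Subsingleton.finite (s := {j : ℤ | ¬ IsCoprime q (pshift F j p)})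
      ?_).union (ih hw0)) ?_
    · intro i hi j hj
      simp only [Set.mem_ofPred_eq, hq.coprime_iff_not_dvd, not_not] at hi hj
      by_contra hij
      have hcop := isCoprime_pshift_pshift_iff.2
        (isCoprime_pshift_self hp.irreducible (sub_ne_zero.2 (Ne.symm hij)))
      exact hq.not_isUnit (hcop.isUnit_of_dvd' hi hj)
    · intro j hj
      by_contra h
      simp only [Set.mem_union, Set.mem_ofPred_eq, not_or, not_not] at h
      exact hj (by rw [map_mul]; exact h.1.mul_right h.2)

theorem stronglyPrime_of_dvd {p q u v : F[X]} (hq : stronglyPrime q u v) (h : p ∣ q) :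
    stronglyPrime p u v :=
  ⟨ne_zero_of_dvd_ne_zero hq.1 h, fun i =>
    ⟨(hq.2 i).1.of_isCoprime_of_dvd_left h, (hq.2 i).2.of_isCoprime_of_dvd_left h⟩⟩

theorem stronglyPrime_mul {p q u v : F[X]} (hp : stronglyPrime p u v)
    (hq : stronglyPrime q u v) : stronglyPrime (p * q) u v :=
  ⟨mul_ne_zero hp.1 hq.1, fun i =>
    ⟨(hp.2 i).1.mul_left (hq.2 i).1, (hp.2 i).2.mul_left (hq.2 i).2⟩⟩

theorem stronglyPrime_pow {p u v : F[X]} (hp : stronglyPrime p u v) (k : ℕ) :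
    stronglyPrime (p ^ k) u v :=
  ⟨pow_ne_zero k hp.1, fun i => ⟨(hp.2 i).1.pow_left, (hp.2 i).2.pow_left⟩⟩

/-- Every shift class of irreducible polynomials has a member that is strongly prime with a
shift-reduced kernel. -/
theorem exists_stronglyPrime_pshift [CharZero F] {u v q : F[X]} (h : shiftReducedPair u v)
    (hq : Irreducible q) : ∃ m : ℤ, stronglyPrime (pshift F m q) u v := by
  obtain ⟨hu, hv, -, hsr⟩ := h
  by_cases hvq : ∃ j : ℤ, ¬ IsCoprime q (pshift F j v)
  · obtain ⟨j, hj⟩ := hvq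
    have huq : ∀ i : ℤ, IsCoprime q (pshift F i u) := by
      intro i
      by_contra hi
      rw [hq.coprime_iff_not_dvd, not_not] at hi hj
      exact hq.not_isUnit
        ((isCoprime_pshift_pshift_iff.2 (hsr (j - i))).isUnit_of_dvd' hi hj)
    obtain ⟨B, hB⟩ := (finite_setOf_not_isCoprime_pshift hq hv).bddAbove
    refine ⟨-(B + 1), pshift_ne_zero hq.ne_zero, fun i => ⟨?_, ?_⟩⟩
    · exact isCoprime_pshift_pshift_iff.2 (huq _)
    · rw [isCoprime_pshift_pshift_iff]
      by_contra hc
      have := hB hc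
      omega
  · push Not at hvq
    obtain ⟨B, hB⟩ := (finite_setOf_not_isCoprime_pshift hq hu).bddBelow
    refine ⟨1 - B, pshift_ne_zero hq.ne_zero, fun i => ⟨?_, ?_⟩⟩
    · rw [isCoprime_pshift_pshift_iff]
      by_contra hc
      have := hB hc
      omega
    · exact isCoprime_pshift_pshift_iff.2 (hvq _)

theorem shiftFree_mul_pow [CharZero F] {b r : F[X]} (hb : shiftFree b) (hr : Irreducible r)
    (h : ∀ i : ℤ, i ≠ 0 → IsCoprime r (pshift F i b)) (k : ℕ) : shiftFree (b * r ^ k) := by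
  refine ⟨mul_ne_zero hb.1 (pow_ne_zero k hr.ne_zero), fun i hi => ?_⟩
  rw [map_mul, map_pow]
  have hbr : IsCoprime b (pshift F i r) :=
    (isCoprime_pshift_left_iff.2 (h (-i) (neg_ne_zero.2 hi))).symm
  exact ((hb.2 i hi).mul_right hbr.pow_right).mul_left
    ((h i hi).pow_left.mul_right (isCoprime_pshift_self hr hi).pow)

/-- A shift-free strongly prime polynomial can be enlarged by a suitable shift of any given
irreducible polynomial. -/
theorem exists_pshift_mul_pow [CharZero F] {u v b q : F[X]} (h : shiftReducedPair u v)
    (hb : shiftFree b) (hbs : stronglyPrime b u v) (hq : Irreducible q) :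
    ∃ m : ℤ, stronglyPrime (pshift F m q) u v ∧
      ∀ k : ℕ, shiftFree (b * pshift F m q ^ k) := by
  by_cases hm : ∃ m : ℤ, pshift F m q ∣ b
  · obtain ⟨m, hm⟩ := hm
    exact ⟨m, stronglyPrime_of_dvd hbs hm, shiftFree_mul_pow hb (irreducible_pshift hq)
      fun i hi => (hb.2 i hi).of_isCoprime_of_dvd_left hm⟩
  · push Not at hm
    obtain ⟨m, hms⟩ := exists_stronglyPrime_pshift h hq
    refine ⟨m, hms, shiftFree_mul_pow hb (irreducible_pshift hq) fun i _ => ?_⟩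
    have := (irreducible_pshift (i := m - i) hq).coprime_iff_not_dvd.2 (hm (m - i))
    rw [isCoprime_pshift_left_iff] at this
    rw [isCoprime_pshift_pshift_iff]
    rwa [neg_sub] at this

end Shift

section Reduction

variable {F : Type*} [Field F]

theorem algebraMap_ratFunc_ne_zero {p : F[X]} (hp : p ≠ 0) :
    algebraMap F[X] (RatFunc F) p ≠ 0 :=
  RatFunc.algebraMap_ne_zero hp

theorem rshift_mk (i : ℤ) (a : F[X]) {b : F[X]} (hb : b ≠ 0) :
    rshift F i (RatFunc.mk a b) = RatFunc.mk (pshift F i a) (pshift F i b) := by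
  have hd := RatFunc.denom_ne_zero (RatFunc.mk a b)
  have h : (RatFunc.mk a b).num * b = a * (RatFunc.mk a b).denom := by
    rw [← RatFunc.mk_eq_mk hd hb, RatFunc.mk_eq_div, RatFunc.num_div_denom]
  rw [rshift, RatFunc.mk_eq_mk (pshift_ne_zero hd) (pshift_ne_zero hb), ← map_mul, h, map_mul]

theorem rshift_add (i : ℤ) (f g : RatFunc F) :
    rshift F i (f + g) = rshift F i f + rshift F i g := by
  have hf := RatFunc.denom_ne_zero f
  have hg := RatFunc.denom_ne_zero g
  have h : f + g = RatFunc.mk (f.num * g.denom + g.num * f.denom) (f.denom * g.denom) := by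
    conv_lhs => rw [← RatFunc.num_div_denom f, ← RatFunc.num_div_denom g]
    rw [RatFunc.mk_eq_div]
    have := algebraMap_ratFunc_ne_zero hf
    have := algebraMap_ratFunc_ne_zero hg
    simp only [map_add, map_mul]
    field_simp
  rw [h, rshift_mk i _ (mul_ne_zero hf hg), rshift, rshift]
  simp only [RatFunc.mk_eq_div]
  have := algebraMap_ratFunc_ne_zero (pshift_ne_zero (i := i) hf)
  have := algebraMap_ratFunc_ne_zero (pshift_ne_zero (i := i) hg)
  simp only [map_add, map_mul]
  field_simp

/-- `f` and `g` agree modulo `K * σ(r) - r` and fractions `p / v`, where `K = u / v`. -/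
def ShellEquiv (u v : F[X]) (f g : RatFunc F) : Prop :=
  ∃ S : RatFunc F, ∃ p : F[X],
    f = RatFunc.mk u v * rshift F 1 S - S + g + RatFunc.mk p v

theorem ShellEquiv.refl (u v : F[X]) (f : RatFunc F) : ShellEquiv u v f f :=
  ⟨RatFunc.mk 0 1, 0, by rw [rshift_mk 1 0 one_ne_zero]; simp [RatFunc.mk_eq_div]⟩

theorem ShellEquiv.add {u v : F[X]} {f₁ f₂ g₁ g₂ : RatFunc F} (h₁ : ShellEquiv u v f₁ g₁)
    (h₂ : ShellEquiv u v f₂ g₂) : ShellEquiv u v (f₁ + f₂) (g₁ + g₂) := by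
  obtain ⟨S₁, p₁, rfl⟩ := h₁
  obtain ⟨S₂, p₂, rfl⟩ := h₂
  refine ⟨S₁ + S₂, p₁ + p₂, ?_⟩
  rw [rshift_add]
  simp only [RatFunc.mk_eq_div, map_add]
  ring

theorem ShellEquiv.trans {u v : F[X]} {f g h : RatFunc F} (h₁ : ShellEquiv u v f g)
    (h₂ : ShellEquiv u v g h) : ShellEquiv u v f h := by
  obtain ⟨S₁, p₁, rfl⟩ := h₁
  obtain ⟨S₂, p₂, rfl⟩ := h₂
  refine ⟨S₁ + S₂, p₁ + p₂, ?_⟩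
  rw [rshift_add]
  simp only [RatFunc.mk_eq_div, map_add]
  ring

theorem exists_shellEquiv_shift_up {u v d : F[X]} (hv : v ≠ 0) (hd : d ≠ 0)
    (h : IsCoprime (pshift F 1 d) v) (a : F[X]) :
    ∃ a' : F[X], ShellEquiv u v (RatFunc.mk a d) (RatFunc.mk a' (pshift F 1 d)) := by
  obtain ⟨y, x, hxy⟩ := h
  refine ⟨x * u * pshift F 1 a, RatFunc.mk (-a) d, y * u * pshift F 1 a, ?_⟩
  rw [rshift_mk 1 _ hd]
  have hA := congrArg (algebraMap F[X] (RatFunc F)) hxy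
  have hv' := algebraMap_ratFunc_ne_zero hv
  have hd' := algebraMap_ratFunc_ne_zero hd
  have hs := algebraMap_ratFunc_ne_zero (pshift_ne_zero (i := 1) hd)
  simp only [RatFunc.mk_eq_div, map_add, map_mul, map_neg, map_one] at hA ⊢
  field_simp
  linear_combination (-(algebraMap F[X] (RatFunc F) u * algebraMap F[X] (RatFunc F) d *
    algebraMap F[X] (RatFunc F) (pshift F 1 a))) * hA

theorem exists_shellEquiv_shift_down {u v d : F[X]} (hv : v ≠ 0) (hd : d ≠ 0)
    (h : IsCoprime (pshift F 1 d) u) (a : F[X]) :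
    ∃ a' : F[X], ShellEquiv u v (RatFunc.mk a (pshift F 1 d)) (RatFunc.mk a' d) := by
  obtain ⟨y, x, hxy⟩ := h
  refine ⟨pshift F (-1) (x * a * v), RatFunc.mk (pshift F (-1) (x * a * v)) d, a * v * y, ?_⟩
  rw [rshift_mk 1 _ hd, pshift_pshift, add_neg_cancel, pshift_zero_index]
  have hA := congrArg (algebraMap F[X] (RatFunc F)) hxy
  have hv' := algebraMap_ratFunc_ne_zero hv
  have hd' := algebraMap_ratFunc_ne_zero hd
  have hs := algebraMap_ratFunc_ne_zero (pshift_ne_zero (i := 1) hd)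
  rw [sub_add_cancel]
  simp only [RatFunc.mk_eq_div, map_add, map_mul, map_one] at hA ⊢
  field_simp
  linear_combination (-(algebraMap F[X] (RatFunc F) a)) * hA

theorem exists_shellEquiv_of_stronglyPrime {u v e : F[X]} (hv : v ≠ 0)
    (he : stronglyPrime e u v) (m : ℤ) (a : F[X]) :
    ∃ a' : F[X], ShellEquiv u v (RatFunc.mk a (pshift F m e)) (RatFunc.mk a' e) := by
  induction m generalizing a with
  | zero => exact ⟨a, by rw [pshift_zero_index]; exact .refl u v _⟩
  | succ n ih =>
    have hshift : pshift F ((n : ℤ) + 1) e = pshift F 1 (pshift F n e) := by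
      rw [pshift_pshift, add_comm]
    rw [hshift]
    obtain ⟨a₁, h₁⟩ := exists_shellEquiv_shift_down (u := u) (v := v) hv (d := pshift F n e)
      (pshift_ne_zero he.1)
      (by rw [← hshift, isCoprime_pshift_left_iff]; exact_mod_cast (he.2 (n + 1)).1) a
    obtain ⟨a₂, h₂⟩ := ih a₁
    exact ⟨a₂, h₁.trans h₂⟩
  | pred n ih =>
    have hshift : pshift F 1 (pshift F (-(n : ℤ) - 1) e) = pshift F (-(n : ℤ)) e := by
      rw [pshift_pshift, add_sub_cancel]
    obtain ⟨a₁, h₁⟩ := exists_shellEquiv_shift_up (u := u) (v := v) hv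
      (d := pshift F (-(n : ℤ) - 1) e) (pshift_ne_zero he.1)
      (by rw [hshift, isCoprime_pshift_left_iff, neg_neg]; exact (he.2 n).2) a
    rw [hshift] at h₁
    obtain ⟨a₂, h₂⟩ := ih a₁
    exact ⟨a₂, h₁.trans h₂⟩

theorem mk_add_mk (a c : F[X]) {b d : F[X]} (hb : b ≠ 0) (hd : d ≠ 0) :
    RatFunc.mk a b + RatFunc.mk c d = RatFunc.mk (a * d + b * c) (b * d) := by
  simp only [RatFunc.mk_eq_div, map_add, map_mul]
  exact div_add_div _ _ (algebraMap_ratFunc_ne_zero hb) (algebraMap_ratFunc_ne_zero hd)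

/-- A fraction with arbitrary denominator can be absorbed into one whose denominator is shift-free
and strongly prime with the kernel. -/
theorem exists_shellEquiv_add [CharZero F] {u v : F[X]} (h : shiftReducedPair u v) (D : F[X]) :
    ∀ c a b : F[X], shiftFree b → stronglyPrime b u v → ∃ a' b' : F[X], shiftFree b' ∧
      stronglyPrime b' u v ∧
      ShellEquiv u v (RatFunc.mk a b + RatFunc.mk c D) (RatFunc.mk a' b') := by
  induction D using UniqueFactorizationMonoid.induction_on_coprime with
  | h0 =>
    intro c a b hb hbs
    refine ⟨a, b, hb, hbs, ?_⟩
    rw [RatFunc.mk_eq_div, RatFunc.mk_eq_div c, map_zero, div_zero, add_zero]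
    exact .refl u v _
  | h1 hD =>
    rename_i D
    intro c a b hb hbs
    obtain ⟨e, he⟩ := hD.dvd (a := c)
    have hD' := algebraMap_ratFunc_ne_zero hD.ne_zero
    refine ⟨a * 1 + b * e, b * 1, by rwa [mul_one], by rwa [mul_one], ?_⟩
    rw [← mk_add_mk _ _ hb.1 one_ne_zero]
    have : RatFunc.mk c D = RatFunc.mk e 1 := by
      rw [he]
      simp [RatFunc.mk_eq_div, hD']
    rw [this]
    exact .refl u v _
  | hpr k hq =>
    rename_i q
    intro c a b hb hbs
    obtain ⟨m, hm, hfree⟩ := exists_pshift_mul_pow h hb hbs hq.irreducible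
    obtain ⟨c', hc'⟩ := exists_shellEquiv_of_stronglyPrime h.2.1 (stronglyPrime_pow hm k) (-m) c
    rw [map_pow, pshift_pshift, neg_add_cancel, pshift_zero_index] at hc'
    refine ⟨a * pshift F m q ^ k + b * c', b * pshift F m q ^ k, hfree k,
      stronglyPrime_mul hbs (stronglyPrime_pow hm k), ?_⟩
    rw [← mk_add_mk a c' hb.1 (pow_ne_zero k hm.1)]
    exact (ShellEquiv.refl u v _).add hc'
  | hcp hxy hx hy =>
    rename_i x y
    intro c a b hb hbs
    by_cases hx0 : x = 0
    · rw [hx0, zero_mul, ← hx0]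
      exact hx c a b hb hbs
    by_cases hy0 : y = 0
    · rw [hy0, mul_zero, ← hy0]
      exact hy c a b hb hbs
    obtain ⟨s, t, hst⟩ := hxy.isCoprime
    obtain ⟨a₁, b₁, hb₁, hbs₁, h₁⟩ := hx (c * t) a b hb hbs
    obtain ⟨a₂, b₂, hb₂, hbs₂, h₂⟩ := hy (c * s) a₁ b₁ hb₁ hbs₁
    refine ⟨a₂, b₂, hb₂, hbs₂, ?_⟩
    have hsum : RatFunc.mk c (x * y) = RatFunc.mk (c * t) x + RatFunc.mk (c * s) y := by
      rw [mk_add_mk _ _ hx0 hy0]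
      congr 1
      linear_combination (-c) * hst
    rw [hsum, ← add_assoc]
    exact (h₁.add (.refl u v _)).trans h₂

end Reduction

/-- Shell reduction: S = K·σ(S₁) − S₁ + a/b + p/v with b shift-free and
strongly prime with K. -/
theorem stmt12 {F : Type*} [Field F] [CharZero F] (u v : Polynomial F) (S : RatFunc F)
    (hsr : shiftReducedPair u v) (hK1 : RatFunc.mk u v ≠ 1) :
    ∃ S₁ : RatFunc F, ∃ a b p : Polynomial F, shiftFree b ∧ stronglyPrime b u v ∧
      S = RatFunc.mk u v * rshift F 1 S₁ - S₁ + RatFunc.mk a b + RatFunc.mk p v := by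
  have h1free : shiftFree (1 : F[X]) := ⟨one_ne_zero, fun _ _ => isCoprime_one_left⟩
  have h1prime : stronglyPrime (1 : F[X]) u v :=
    ⟨one_ne_zero, fun _ => ⟨isCoprime_one_left, isCoprime_one_left⟩⟩
  obtain ⟨a, b, hb, hbs, S₁, p, hS⟩ :=
    exists_shellEquiv_add hsr S.denom S.num 0 1 h1free h1prime
  refine ⟨S₁, a, b, p, hb, hbs, ?_⟩
  rw [← hS]
  simp [RatFunc.mk_eq_div, RatFunc.num_div_denom]
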